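/- arXiv:1112.0405 — 2 statements merged into one kernel-verified Lean document; each statement's English description precedes it below -/
import Mathlib

section
/- Let M be a 2×2 matrix over ℤ/4ℤ with determinant 3 (i.e. −1 in ℤ/4ℤ), whose reduction modulo 2 is not the identity matrix but whose reduction modulo 2 squares to the identity. Then the trace of M is 0 or 2 in ℤ/4ℤ; moreover M² = 1 if and only if trace M = 0, and if trace M = 2 then M⁴ = 1 and M² ≠ 1 (so M has order 4). -/
set_option maxRecDepth 10000 in
theorem stmt_3 (M : Matrix (Fin 2) (Fin 2) (ZMod 4))
    (hdet : M.det = 3)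
    (hne : M.map (ZMod.castHom (by norm_num : (2 : ℕ) ∣ 4) (ZMod 2)) ≠ 1)
    (hsq : (M.map (ZMod.castHom (by norm_num : (2 : ℕ) ∣ 4) (ZMod 2))) ^ 2 = 1) :
    (M.trace = 0 ∨ M.trace = 2) ∧
    (M ^ 2 = 1 ↔ M.trace = 0) ∧
    (M.trace = 2 → M ^ 4 = 1 ∧ M ^ 2 ≠ 1) := by
  have pow_four : M ^ 4 = M ^ 2 * M ^ 2 := by rw [← pow_add]
  rw [pow_four]
  obtain ⟨a, b, c, d, rfl⟩ : ∃ a b c d, M = !![a, b; c, d] := ⟨_, _, _, _, M.eta_fin_two⟩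
  simp only [pow_two, Matrix.det_fin_two_of, Matrix.trace_fin_two_of, Matrix.mul_fin_two,
    ← Matrix.ext_iff, Fin.forall_fin_two, Matrix.map_apply, Matrix.mul_apply, Fin.sum_univ_two,
    Matrix.one_fin_two, Matrix.of_apply, Matrix.cons_val', Matrix.cons_val_zero,
    Matrix.cons_val_one, Matrix.cons_val_fin_one, ne_eq, ZMod.castHom_apply] at *
  clear pow_four
  revert a b c d
  decide
end

section
/- Let F = x₀⁸ + x₁⁸ + x₂⁸ + x₃⁸ + 14·(x₀⁴x₁⁴ + x₀⁴x₂⁴ + x₀⁴x₃⁴ + x₁⁴x₂⁴ + x₁⁴x₃⁴ + x₂⁴x₃⁴) + 168·x₀²x₁²x₂²x₃², regarded as a polynomial in four variables over ℤ. Let k be an algebraically closed field in which 2, 3 and 5 are all nonzero (i.e. the characteristic of k is not 2, 3 or 5). Then the only common zero in k⁴ of the four partial derivatives ∂F/∂x₀, ∂F/∂x₁, ∂F/∂x₂, ∂F/∂x₃ is the origin (0,0,0,0). Consequently Maschke's octic surface {F = 0} ⊂ ℙ³ is smooth over such k. -/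
open MvPolynomial

/-- Maschke's octic polynomial over `ℤ`. -/
noncomputable def maschkeOctic : MvPolynomial (Fin 4) ℤ :=
  X 0 ^ 8 + X 1 ^ 8 + X 2 ^ 8 + X 3 ^ 8
    + 14 * (X 0 ^ 4 * X 1 ^ 4 + X 0 ^ 4 * X 2 ^ 4 + X 0 ^ 4 * X 3 ^ 4
        + X 1 ^ 4 * X 2 ^ 4 + X 1 ^ 4 * X 3 ^ 4 + X 2 ^ 4 * X 3 ^ 4)
    + 168 * (X 0 ^ 2 * X 1 ^ 2 * X 2 ^ 2 * X 3 ^ 2)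

/-- Vieta's formulas for two distinct roots of `6 y ^ 2 = s y + 42 p`. -/
lemma vieta_of_ne {k : Type*} [Field k] (h6 : (6 : k) ≠ 0) {s p y z : k} (hyz : y ≠ z)
    (hy : 6 * y ^ 2 = s * y + 42 * p) (hz : 6 * z ^ 2 = s * z + 42 * p) :
    6 * (y + z) = s ∧ y * z = -7 * p := by
  have hs : 6 * (y + z) = s :=
    mul_left_cancel₀ (sub_ne_zero.mpr hyz) (by linear_combination hy - hz)
  exact ⟨hs, mul_left_cancel₀ h6 (by linear_combination y * hs - hy)⟩

lemma eq_or_eq_of_ne {k : Type*} [Field k] (h6 : (6 : k) ≠ 0) {s p y z w : k} (hyz : y ≠ z)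
    (hy : 6 * y ^ 2 = s * y + 42 * p) (hz : 6 * z ^ 2 = s * z + 42 * p)
    (hw : 6 * w ^ 2 = s * w + 42 * p) : w = y ∨ w = z := by
  obtain ⟨hs, hp⟩ := vieta_of_ne h6 hyz hy hz
  have : 6 * ((w - y) * (w - z)) = 0 := by linear_combination hw - w * hs + 6 * hp
  simpa [h6, sub_eq_zero] using this

/-- Four roots of `6 y ^ 2 = 7 s y + 42 p`, where `s` is their sum and `p ^ 2` their product,
cannot take the value `y` three times and `z` once with `y ≠ z`. -/
lemma eq_of_three_one {k : Type*} [Field k] (h2 : (2 : k) ≠ 0) (h3 : (3 : k) ≠ 0)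
    (h5 : (5 : k) ≠ 0) {s p y z : k} (hs : s = 3 * y + z) (hp : p ^ 2 = y ^ 3 * z)
    (hy : 6 * y ^ 2 = 7 * s * y + 42 * p) (hz : 6 * z ^ 2 = 7 * s * z + 42 * p) : y = z := by
  by_contra hyz
  have h6 : (6 : k) ≠ 0 := by convert mul_ne_zero h2 h3 using 1; norm_num
  obtain ⟨hsum, hprod⟩ := vieta_of_ne h6 hyz hy hz
  obtain rfl : z = -15 * y := by linear_combination -hsum - 7 * hs
  have : 2 ^ 6 * 3 * 5 * y ^ 4 = 0 := by
    linear_combination (-15 * y ^ 2 - 7 * p) * hprod + 49 * hp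
  have hy0 : y = 0 := by simpa [h2, h3, h5] using this
  simp [hy0] at hyz

/-- Four roots of `6 y ^ 2 = 7 s y + 42 p`, where `s` is their sum and `p ^ 2` their product,
cannot take two distinct values twice each. -/
lemma eq_of_two_two {k : Type*} [Field k] (h2 : (2 : k) ≠ 0) (h3 : (3 : k) ≠ 0)
    {s p y z : k} (hs : s = 2 * y + 2 * z) (hp : p ^ 2 = y ^ 2 * z ^ 2)
    (hy : 6 * y ^ 2 = 7 * s * y + 42 * p) (hz : 6 * z ^ 2 = 7 * s * z + 42 * p) : y = z := by
  by_contra hyz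
  have h6 : (6 : k) ≠ 0 := by convert mul_ne_zero h2 h3 using 1; norm_num
  obtain ⟨hsum, hprod⟩ := vieta_of_ne h6 hyz hy hz
  have hadd : 2 ^ 3 * (y + z) = 0 := by linear_combination -hsum - 7 * hs
  obtain rfl : z = -y := by
    have : y + z = 0 := by simpa [h2] using hadd
    linear_combination this
  have : 2 ^ 4 * 3 * y ^ 4 = 0 := by
    linear_combination (y ^ 2 + 7 * p) * hprod - 49 * hp
  have hy0 : y = 0 := by simpa [h2, h3] using this
  simp [hy0] at hyz

lemma eq_of_sum_of_prod {k : Type*} [Field k] (h2 : (2 : k) ≠ 0) (h3 : (3 : k) ≠ 0)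
    (h5 : (5 : k) ≠ 0) {s p a b c d : k} (hs : s = a + b + c + d) (hp : p ^ 2 = a * b * c * d)
    (ha : 6 * a ^ 2 = 7 * s * a + 42 * p) (hb : 6 * b ^ 2 = 7 * s * b + 42 * p)
    (hc : 6 * c ^ 2 = 7 * s * c + 42 * p) (hd : 6 * d ^ 2 = 7 * s * d + 42 * p) : a = b := by
  by_contra hab
  have h6 : (6 : k) ≠ 0 := by convert mul_ne_zero h2 h3 using 1; norm_num
  rcases eq_or_eq_of_ne h6 hab ha hb hc with rfl | rfl <;>
    rcases eq_or_eq_of_ne h6 hab ha hb hd with rfl | rfl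
  · exact hab (eq_of_three_one h2 h3 h5 (by rw [hs]; ring) (by rw [hp]; ring) ha hb)
  · exact hab (eq_of_two_two h2 h3 (by rw [hs]; ring) (by rw [hp]; ring) ha hb)
  · exact hab (eq_of_two_two h2 h3 (by rw [hs]; ring) (by rw [hp]; ring) ha hb)
  · exact hab (eq_of_three_one h2 h3 h5 (by rw [hs]; ring) (by rw [hp]; ring) hb ha).symm

/-- Four roots of `6 y ^ 2 = 7 s y + 42 p`, where `s` is their sum and `p ^ 2` their product,
vanish. -/
lemma eq_zero_of_sum_of_prod {k : Type*} [Field k] (h2 : (2 : k) ≠ 0) (h3 : (3 : k) ≠ 0)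
    (h5 : (5 : k) ≠ 0) {s p : k} {y : Fin 4 → k} (hs : s = y 0 + y 1 + y 2 + y 3)
    (hp : p ^ 2 = y 0 * y 1 * y 2 * y 3)
    (hy : ∀ i, 6 * y i ^ 2 = 7 * s * y i + 42 * p) : y = 0 := by
  have h01 : y 0 = y 1 := eq_of_sum_of_prod h2 h3 h5 hs hp (hy 0) (hy 1) (hy 2) (hy 3)
  have h02 : y 0 = y 2 := eq_of_sum_of_prod h2 h3 h5 (b := y 2) (c := y 1)
    (by rw [hs]; ring) (by rw [hp]; ring) (hy 0) (hy 2) (hy 1) (hy 3)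
  have h03 : y 0 = y 3 := eq_of_sum_of_prod h2 h3 h5 (b := y 3) (c := y 1) (d := y 2)
    (by rw [hs]; ring) (by rw [hp]; ring) (hy 0) (hy 3) (hy 1) (hy 2)
  rw [← h01, ← h02, ← h03] at hs hp
  have h0 := hy 0
  rw [hs] at h0
  have : 2 ^ 8 * 5 * y 0 ^ 4 = 0 := by
    linear_combination (22 * y 0 ^ 2 - 42 * p) * h0 - 42 ^ 2 * hp
  have hy0 : y 0 = 0 := by simpa [h2, h5] using this
  ext i
  fin_cases i <;> simp [← h01, ← h02, ← h03, hy0]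

theorem stmt_10 (k : Type*) [Field k] [IsAlgClosed k]
    (h2 : (2 : k) ≠ 0) (h3 : (3 : k) ≠ 0) (h5 : (5 : k) ≠ 0)
    (x : Fin 4 → k)
    (hx : ∀ i : Fin 4, MvPolynomial.aeval x (MvPolynomial.pderiv i maschkeOctic) = 0) :
    x = 0 := by
  have h8 : (8 : k) ≠ 0 := by convert pow_ne_zero 3 h2 using 1; norm_num
  have hy : (fun i => x i ^ 4) = 0 := by
    refine eq_zero_of_sum_of_prod h2 h3 h5 (p := x 0 ^ 2 * x 1 ^ 2 * x 2 ^ 2 * x 3 ^ 2)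
      rfl (by ring) fun i => ?_
    have hi := hx i
    have h14 : pderiv i (14 : MvPolynomial (Fin 4) ℤ) = 0 := (pderiv i).map_natCast 14
    have h168 : pderiv i (168 : MvPolynomial (Fin 4) ℤ) = 0 := (pderiv i).map_natCast 168
    simp only [maschkeOctic, map_add, Derivation.leibniz, h14, h168] at hi
    fin_cases i <;>
      simp [Derivation.leibniz_pow, pderiv_X] at hi ⊢ <;>
      apply mul_left_cancel₀ h8
    · linear_combination -x 0 * hi
    · linear_combination -x 1 * hi
    · linear_combination -x 2 * hi
    · linear_combination -x 3 * hi
  ext i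
  simpa using congrFun hy i
end
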